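/- arXiv:2312.02630 — 2 statements merged into one kernel-verified Lean document; each statement's English description precedes it below -/
import Mathlib

section
/- Let w ∈ W and let β₁,…,β_n ∈ Φ be roots such that w = s_{β₁}⋯s_{β_n} is the product of the corresponding reflections. Let U be the ℚ-subspace of the root space spanned by the σ-averages avg_σ(β₁),…,avg_σ(β_n). Then ℓ_{R,σ}(w) ≤ dim U. -/
noncomputable section
open scoped Classical

/-- A finite crystallographic reduced root system `Φ` with positive system `pos` and
simple system `Δ`, realized in the dual of the rational coweight space `V = Λ ⊗ ℚ`;
`Λ` is a Weyl- and `σ`-stable lattice containing the coroots, and `σ` is a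
finite-order automorphism of `V` (the Frobenius) whose dual action preserves `Φ` and `Δ`,
acting on the Weyl group by `σ(s_α) = s_{σ(α)}`.  The reflection `s_α` is recorded by the
field `refl`, pinned down on roots by `refl_apply`. -/
structure Setting (V : Type*) [AddCommGroup V] [Module ℚ V] where
  Φ : Finset (Module.Dual ℚ V)
  pos : Finset (Module.Dual ℚ V)
  Δ : Finset (Module.Dual ℚ V)
  coroot : Module.Dual ℚ V → V
  refl : Module.Dual ℚ V → V ≃ₗ[ℚ] V
  Λ : AddSubgroup V
  σ : V ≃ₗ[ℚ] V
  M : ℕ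
  M_pos : 0 < M
  σ_pow_eq_one : σ ^ M = 1
  finiteDimensional : FiniteDimensional ℚ V
  zero_not_root : (0 : Module.Dual ℚ V) ∉ Φ
  pos_subset : pos ⊆ Φ
  simple_subset : Δ ⊆ pos
  root_pos_or_neg : ∀ α ∈ Φ, α ∈ pos ∨ -α ∈ pos
  pos_not_neg : ∀ α ∈ pos, -α ∉ pos
  neg_root : ∀ α ∈ Φ, -α ∈ Φ
  reduced : ∀ α ∈ Φ, ∀ c : ℚ, c • α ∈ Φ → c = 1 ∨ c = -1
  root_coroot_two : ∀ α ∈ Φ, α (coroot α) = 2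
  crystallographic : ∀ α ∈ Φ, ∀ β ∈ Φ, ∃ n : ℤ, α (coroot β) = (n : ℚ)
  pos_simple_comb : ∀ α ∈ pos, ∃ c : Module.Dual ℚ V → ℚ,
    (∀ β, 0 ≤ c β) ∧ α = ∑ β ∈ Δ, c β • β
  refl_apply : ∀ α ∈ Φ, ∀ v : V, refl α v = v - α v • coroot α
  root_refl_stable : ∀ α ∈ Φ, ∀ β ∈ Φ, β - β (coroot α) • α ∈ Φ
  coroot_mem_lattice : ∀ α ∈ Φ, coroot α ∈ Λ
  lattice_refl_stable : ∀ α ∈ Φ, ∀ v ∈ Λ, refl α v ∈ Λ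
  lattice_σ_stable : ∀ v ∈ Λ, σ v ∈ Λ
  lattice_spans : Submodule.span ℚ (Λ : Set V) = ⊤
  lattice_pairing_int : ∀ α ∈ Φ, ∀ v ∈ Λ, ∃ n : ℤ, α v = (n : ℚ)
  σ_root : ∀ α ∈ Φ, α ∘ₗ (σ.symm : V →ₗ[ℚ] V) ∈ Φ
  σ_simple : ∀ α ∈ Δ, α ∘ₗ (σ.symm : V →ₗ[ℚ] V) ∈ Δ
  σ_coroot : ∀ α ∈ Φ, σ (coroot α) = coroot (α ∘ₗ (σ.symm : V →ₗ[ℚ] V))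

namespace Setting

variable {V : Type*} [AddCommGroup V] [Module ℚ V] (S : Setting V)

/-- The dual (inverse-transpose) action of `σ` on the root space: `σ(α) = α ∘ σ⁻¹`. -/
def dualAct (α : Module.Dual ℚ V) : Module.Dual ℚ V := α ∘ₗ (S.σ.symm : V →ₗ[ℚ] V)

/-- The dual action of a Weyl group element `w` on roots: `(wα)(v) = α(w⁻¹ v)`. -/
def wAct (w : V ≃ₗ[ℚ] V) (α : Module.Dual ℚ V) : Module.Dual ℚ V :=
  α ∘ₗ (w.symm : V →ₗ[ℚ] V)

/-- The action of `σ` on the Weyl group (on linear automorphisms): `w ↦ σ ∘ w ∘ σ⁻¹`;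
it satisfies `σ(s_α) = s_{σ(α)}`. -/
def σW (w : V ≃ₗ[ℚ] V) : V ≃ₗ[ℚ] V := S.σ * w * S.σ⁻¹

/-- The standard parabolic subgroup `W_J` generated by the reflections `s_α`, `α ∈ J`. -/
def weylSub (J : Set (Module.Dual ℚ V)) : Subgroup (V ≃ₗ[ℚ] V) :=
  Subgroup.closure (S.refl '' J)

/-- The (finite) Weyl group `W`, generated by the simple reflections. -/
def weyl : Subgroup (V ≃ₗ[ℚ] V) := S.weylSub ↑S.Δ

/-- `l` is a word over the alphabet `J` of roots, with product `w`. -/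
def IsWord (J : Set (Module.Dual ℚ V)) (l : List (Module.Dual ℚ V)) (w : V ≃ₗ[ℚ] V) : Prop :=
  (∀ α ∈ l, α ∈ J) ∧ (l.map S.refl).prod = w

/-- Coxeter length of `w ∈ W` with respect to the simple reflections. -/
def len (w : V ≃ₗ[ℚ] V) : ℕ :=
  sInf {n | ∃ l : List (Module.Dual ℚ V), S.IsWord ↑S.Δ l w ∧ l.length = n}

/-- A reduced word for `w`. -/
def IsReducedWord (l : List (Module.Dual ℚ V)) (w : V ≃ₗ[ℚ] V) : Prop :=
  S.IsWord ↑S.Δ l w ∧ l.length = S.len w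

/-- The support of `w`: the set of simple roots occurring in some reduced word of `w`. -/
def supp (w : V ≃ₗ[ℚ] V) : Set (Module.Dual ℚ V) :=
  {α | ∃ l, S.IsReducedWord l w ∧ α ∈ l}

/-- `β` lies in the `σ`-orbit of `α` (in the root space). -/
def sOrbit (α β : Module.Dual ℚ V) : Prop := ∃ i : ℕ, (S.dualAct)^[i] α = β

/-- The `σ`-support `supp_σ(w) = ∪_i σ^i(supp w)`. -/
def suppSigma (w : V ≃ₗ[ℚ] V) : Set (Module.Dual ℚ V) :=
  {β | ∃ α ∈ S.supp w, S.sOrbit α β}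

/-- A subset of the root space is `σ`-stable. -/
def SStable (J : Set (Module.Dual ℚ V)) : Prop := ∀ α ∈ J, S.dualAct α ∈ J

/-- `w` is a product of reflections along roots of `J` lying in pairwise distinct
`σ`-orbits (a partial `σ`-Coxeter element, when `J ⊆ Δ`). -/
def IsPartialCoxIn (J : Set (Module.Dual ℚ V)) (w : V ≃ₗ[ℚ] V) : Prop :=
  ∃ l : List (Module.Dual ℚ V), (∀ α ∈ l, α ∈ J) ∧
    l.Pairwise (fun α β => ¬ S.sOrbit α β) ∧ (l.map S.refl).prod = w

/-- `w` is a `σ`-Coxeter element of `W_J`: a product of simple reflections of `J`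
containing exactly one from each `σ`-orbit of `J`. -/
def IsSigmaCox (J : Set (Module.Dual ℚ V)) (w : V ≃ₗ[ℚ] V) : Prop :=
  ∃ l : List (Module.Dual ℚ V), (∀ α ∈ l, α ∈ J) ∧
    l.Pairwise (fun α β => ¬ S.sOrbit α β) ∧
    (∀ α ∈ J, ∃ β ∈ l, S.sOrbit β α) ∧ (l.map S.refl).prod = w

/-- The fixed space of an endomorphism of `V`. -/
def fixedSpace (f : V →ₗ[ℚ] V) : Submodule ℚ V := LinearMap.ker (f - LinearMap.id)

/-- The `σ`-twisted reflection length defect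
`ℓ_{R,σ}(w) = dim V^σ − dim V^{σ∘w}`. -/
def ellR (w : V ≃ₗ[ℚ] V) : ℤ :=
  (Module.finrank ℚ (fixedSpace S.σ.toLinearMap) : ℤ) -
    (Module.finrank ℚ (fixedSpace (S.σ * w).toLinearMap) : ℤ)

/-- The `σ`-average `avg_σ(β) = (1/M) ∑_{k=1}^M σ^k(β)` of an element of the root space. -/
def avgRoot (β : Module.Dual ℚ V) : Module.Dual ℚ V :=
  (S.M : ℚ)⁻¹ • ∑ k ∈ Finset.range S.M, (S.dualAct)^[k + 1] β

/-- The `σ`-average of a coweight. -/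
def avg (v : V) : V := (S.M : ℚ)⁻¹ • ∑ k ∈ Finset.range S.M, (S.σ ^ (k + 1)) v

/-- `π_J(λ) = avg_σ((1/#W_J) ∑_{u ∈ W_J} u(λ))`. -/
def piJ (J : Set (Module.Dual ℚ V)) (lam : V) : V :=
  S.avg ((Nat.card ↥(S.weylSub J) : ℚ)⁻¹ • ∑ᶠ u : ↥(S.weylSub J), (u : V ≃ₗ[ℚ] V) lam)

/-- The number `#(J/σ)` of `σ`-orbits in `J`. -/
def orbCount (J : Set (Module.Dual ℚ V)) : ℕ :=
  Nat.card ↥((fun α => {β | S.sOrbit α β}) '' J)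

/-- A coweight is dominant if it pairs nonnegatively with every positive root. -/
def IsDominant (v : V) : Prop := ∀ α ∈ S.pos, 0 ≤ α v

/-- The (non-dominant) Newton point `ν_x = (1/N) ∑_{k=1}^N (σw)^k(μ)` of `x = wε^μ`. -/
def nuX (w : V ≃ₗ[ℚ] V) (μ : V) (N : ℕ) : V :=
  (N : ℚ)⁻¹ • ∑ k ∈ Finset.range N, ((S.σ * w) ^ (k + 1)) μ

/-! Elements `x = wε^μ` of the extended affine Weyl group `W̃ = W ⋉ Λ` are encoded as
pairs `(w, μ)`.  Since `ε^μ w' = w' ε^{w'⁻¹μ}`, multiplication is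
`(w,μ)·(w',μ') = (ww', w'⁻¹μ + μ')`. -/

/-- Multiplication in `W̃`. -/
def mulE (x y : (V ≃ₗ[ℚ] V) × V) : (V ≃ₗ[ℚ] V) × V := (x.1 * y.1, y.1.symm x.2 + y.2)

/-- Inversion in `W̃`. -/
def invE (x : (V ≃ₗ[ℚ] V) × V) : (V ≃ₗ[ℚ] V) × V := (x.1⁻¹, -(x.1 x.2))

/-- The action of `σ` on `W̃`: `σ(wε^μ) = σ(w)ε^{σ(μ)}`. -/
def sigmaE (x : (V ≃ₗ[ℚ] V) × V) : (V ≃ₗ[ℚ] V) × V := (S.σW x.1, S.σ x.2)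

/-- The pair `(w,μ)` is a genuine element of `W̃ = W ⋉ Λ`. -/
def memE (x : (V ≃ₗ[ℚ] V) × V) : Prop := x.1 ∈ S.weyl ∧ x.2 ∈ S.Λ

/-- The `σ`-conjugate `y⁻¹ x σ(y)`. -/
def sigmaConjE (y x : (V ≃ₗ[ℚ] V) × V) : (V ≃ₗ[ℚ] V) × V :=
  mulE (mulE (invE y) x) (S.sigmaE y)

/-- Indicator function `Φ⁺(·)` of the set of positive roots. -/
def ind (α : Module.Dual ℚ V) : ℚ := if α ∈ S.pos then 1 else 0

/-- The length functional `ℓ(x,α) = −Φ⁺(wα) + ⟨μ,α⟩ + Φ⁺(α)` for `x = (w,μ)`. -/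
def ellA (x : (V ≃ₗ[ℚ] V) × V) (α : Module.Dual ℚ V) : ℚ :=
  - S.ind (wAct x.1 α) + α x.2 + S.ind α

/-- The length of `x ∈ W̃`: `ℓ(x) = ∑_{α ∈ Φ⁺} |ℓ(x,α)|`. -/
def ellE (x : (V ≃ₗ[ℚ] V) × V) : ℚ := ∑ α ∈ S.pos, |S.ellA x α|

/-- The set `LP(x)` of length positive elements of `x`. -/
def LP (x : (V ≃ₗ[ℚ] V) × V) : Set (V ≃ₗ[ℚ] V) :=
  {v | v ∈ S.weyl ∧ ∀ α ∈ S.pos, 0 ≤ S.ellA x (wAct v α)}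

/-- `x` has minimal length in its `σ`-conjugacy class in `W̃`. -/
def IsMinLengthE (x : (V ≃ₗ[ℚ] V) × V) : Prop :=
  ∀ y : (V ≃ₗ[ℚ] V) × V, S.memE y → S.ellE x ≤ S.ellE (S.sigmaConjE y x)

/-- `θ` is the highest root of an irreducible component of `Φ`: it is positive and cannot
be increased by any simple root. -/
def IsHighestRoot (θ : Module.Dual ℚ V) : Prop := θ ∈ S.pos ∧ ∀ α ∈ S.Δ, θ + α ∉ S.Φ

/-- Simple affine roots: `(α,0)` for `α ∈ Δ` and `(−θ,1)` for `θ` the highest root of an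
irreducible component of `Φ`. -/
def IsSimpleAffine (a : Module.Dual ℚ V × ℤ) : Prop :=
  (a.2 = 0 ∧ a.1 ∈ S.Δ) ∨ (a.2 = 1 ∧ S.IsHighestRoot (-a.1))

/-- The affine reflection `r_a = s_α ε^{kα^∨}` for `a = (α,k)`. -/
def raff (a : Module.Dual ℚ V × ℤ) : (V ≃ₗ[ℚ] V) × V := (S.refl a.1, a.2 • S.coroot a.1)

/-- `σ(α,k) := (σ(α),k)`. -/
def sigmaAff (a : Module.Dual ℚ V × ℤ) : Module.Dual ℚ V × ℤ := (S.dualAct a.1, a.2)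

/-- `(x,v)` is a positive Coxeter pair with support `J`:  `v ∈ LP(x)`, `J ⊆ Δ` is
`σ`-stable, and `v⁻¹σ(wv)` is a `σ`-Coxeter element of `W_J`. -/
def IsPosCoxPair (x : (V ≃ₗ[ℚ] V) × V) (v : V ≃ₗ[ℚ] V)
    (J : Set (Module.Dual ℚ V)) : Prop :=
  v ∈ S.LP x ∧ J ⊆ ↑S.Δ ∧ S.SStable J ∧ S.IsSigmaCox J (v⁻¹ * S.σW (x.1 * v))

/-- `2ρ`, the sum of the positive roots. -/
def twoRho : Module.Dual ℚ V := ∑ β ∈ S.pos, β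

/-- An edge `u → u s_α` of the quantum Bruhat graph. -/
def qbgStep (u u' : V ≃ₗ[ℚ] V) : Prop :=
  ∃ α ∈ S.pos, u' = u * S.refl α ∧
    ((S.len u' : ℚ) = S.len u + 1 ∨ (S.len u' : ℚ) = S.len u + 1 - S.twoRho (S.coroot α))

/-- The distance `d_QBG(u ⇒ u')` in the quantum Bruhat graph. -/
def dQBG (u u' : V ≃ₗ[ℚ] V) : ℕ :=
  sInf {n | ∃ f : ℕ → (V ≃ₗ[ℚ] V), f 0 = u ∧ f n = u' ∧ ∀ i < n, S.qbgStep (f i) (f (i + 1))}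

/-- `u ∈ W^J`: a minimal length representative of its coset `uW_J`. -/
def IsMinRep (J : Set (Module.Dual ℚ V)) (u : V ≃ₗ[ℚ] V) : Prop :=
  u ∈ S.weyl ∧ ∀ z ∈ S.weylSub J, S.len u ≤ S.len (u * z)

/-- `I(ν) = {α ∈ Δ : ⟨ν,α⟩ = 0}`. -/
def Inu (ν : V) : Set (Module.Dual ℚ V) := {α | α ∈ S.Δ ∧ α ν = 0}

/-- Adjacency in the Dynkin diagram. -/
def adj (α β : Module.Dual ℚ V) : Prop := α ≠ β ∧ α (S.coroot β) ≠ 0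

/-- Connectivity within `I` of the Dynkin diagram of `I`. -/
def connIn (I : Set (Module.Dual ℚ V)) (α β : Module.Dual ℚ V) : Prop :=
  Relation.ReflTransGen (fun a b => a ∈ I ∧ b ∈ I ∧ S.adj a b) α β

/-- `C` is a union of connected components of the Dynkin diagram of `I`. -/
def IsCompClosed (I C : Set (Module.Dual ℚ V)) : Prop :=
  C ⊆ I ∧ ∀ α ∈ C, ∀ β ∈ I, S.connIn I α β → β ∈ C

/-- `C` is a `σ`-connected component of the `σ`-stable set `I`: a minimal nonempty
`σ`-stable subset of `I` that is a union of connected components of `I`. -/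
def IsSigmaComponent (I C : Set (Module.Dual ℚ V)) : Prop :=
  C.Nonempty ∧ S.SStable C ∧ S.IsCompClosed I C ∧
    ∀ C' : Set (Module.Dual ℚ V), C'.Nonempty → S.SStable C' → S.IsCompClosed I C' →
      C' ⊆ C → C' = C

@[simp]
lemma mem_fixedSpace {f : V →ₗ[ℚ] V} {v : V} : v ∈ fixedSpace f ↔ f v = v := by
  simp [fixedSpace, sub_eq_zero]

lemma dualAct_iterate_apply {v : V} (hv : S.σ v = v) (β : Module.Dual ℚ V) (k : ℕ) :
    (S.dualAct)^[k] β v = β v := by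
  have hv' : S.σ.symm v = v := by rw [LinearEquiv.symm_apply_eq, hv]
  induction k with
  | zero => rfl
  | succ k ih => simp [Function.iterate_succ_apply', dualAct, hv', ih]

/-- On the fixed space of `σ`, a root agrees with its `σ`-average. -/
lemma avgRoot_apply {v : V} (hv : S.σ v = v) (β : Module.Dual ℚ V) :
    S.avgRoot β v = β v := by
  have hM : (S.M : ℚ) ≠ 0 := Nat.cast_ne_zero.mpr S.M_pos.ne'
  simp only [avgRoot, LinearMap.smul_apply, LinearMap.sum_apply, S.dualAct_iterate_apply hv,
    Finset.sum_const, Finset.card_range, nsmul_eq_mul, smul_eq_mul]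
  field_simp

/-- A product of reflections fixes every vector killed by all of the roots involved. -/
lemma prod_refl_apply_eq_self {v : V} (l : List (Module.Dual ℚ V)) (hl : ∀ β ∈ l, β ∈ S.Φ)
    (hv : ∀ β ∈ l, β v = 0) : (l.map S.refl).prod v = v := by
  induction l with
  | nil => rfl
  | cons β l ih =>
    simp only [List.mem_cons, forall_eq_or_imp] at hl hv
    simp [ih hl.2 hv.2, S.refl_apply β hl.1, hv.1]

/-- If `w = s_{β₁}⋯s_{β_n}` is a product of reflections along roots
`β₁,…,β_n ∈ Φ` and `U` is the span of the `σ`-averages of the `βᵢ`, then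
`ℓ_{R,σ}(w) ≤ dim U`. -/
theorem statement0 (w : V ≃ₗ[ℚ] V) (hw : w ∈ S.weyl)
    (l : List (Module.Dual ℚ V)) (hl : ∀ β ∈ l, β ∈ S.Φ)
    (hprod : (l.map S.refl).prod = w) :
    S.ellR w ≤
      (Module.finrank ℚ ↥(Submodule.span ℚ (S.avgRoot '' {β | β ∈ l})) : ℤ) := by
  have := S.finiteDimensional
  set U := Submodule.span ℚ (S.avgRoot '' {β | β ∈ l})
  have hle : fixedSpace S.σ.toLinearMap ⊓ U.dualCoannihilator ≤
      fixedSpace (S.σ * w).toLinearMap := by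
    rintro v ⟨hσ, hv⟩
    replace hσ : S.σ v = v := mem_fixedSpace.mp hσ
    have hroots : ∀ β ∈ l, β v = 0 := fun β hβ => by
      rw [← S.avgRoot_apply hσ]
      exact (Submodule.mem_dualCoannihilator v).mp hv _
        (Submodule.subset_span (Set.mem_image_of_mem _ hβ))
    simp [← hprod, S.prod_refl_apply_eq_self l hl hroots, hσ]
  have hdim := Submodule.finrank_mono hle
  have hinf := Submodule.finrank_sup_add_finrank_inf_eq
    (fixedSpace S.σ.toLinearMap) U.dualCoannihilator
  have hsup := Submodule.finrank_le (fixedSpace S.σ.toLinearMap ⊔ U.dualCoannihilator)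
  have hco := Subspace.finrank_add_finrank_dualCoannihilator_eq U
  rw [ellR]
  omega

end Setting
end
end

section
/- Let (x₁,v₁) and (x₂,v₂), with x_i = w_iε^{μ_i} ∈ W̃, be positive Coxeter pairs with the same support J, and set c_i := v_i⁻¹σ(w_iv_i) ∈ W_J. Suppose there exists u ∈ W_J with σ⁻¹(u)·c₁·u⁻¹ = c₂ such that u(σ(v₁⁻¹μ₁)) − σ(v₂⁻¹μ₂) lies in the image of the endomorphism (id − σ∘c₂) of Λ (i.e. the pairs have the same J-point). Then x₁ and x₂ are σ-conjugate in W̃. -/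
noncomputable section
open scoped Classical

namespace Setting

variable {V : Type*} [AddCommGroup V] [Module ℚ V] (S : Setting V)

theorem weylSub_le_weyl {J : Set (Module.Dual ℚ V)} (hJ : J ⊆ ↑S.Δ) :
    S.weylSub J ≤ S.weyl :=
  Subgroup.closure_mono (Set.image_mono hJ)

theorem mem_root_of_mem_simple {α : Module.Dual ℚ V} (hα : α ∈ S.Δ) : α ∈ S.Φ :=
  S.pos_subset (S.simple_subset hα)

theorem refl_refl {α : Module.Dual ℚ V} (hα : α ∈ S.Φ) (v : V) :
    S.refl α (S.refl α v) = v := by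
  simp only [S.refl_apply α hα, map_sub, map_smul, S.root_coroot_two α hα, smul_eq_mul]
  module

theorem apply_mem_lattice_iff_of_mem_weyl {w : V ≃ₗ[ℚ] V} (hw : w ∈ S.weyl) :
    ∀ v, w v ∈ S.Λ ↔ v ∈ S.Λ := by
  unfold weyl weylSub at hw
  induction hw using Subgroup.closure_induction with
  | mem x hx =>
    obtain ⟨α, hα, rfl⟩ := hx
    have hΦ := S.mem_root_of_mem_simple hα
    refine fun v => ⟨fun h => ?_, S.lattice_refl_stable α hΦ v⟩
    simpa only [S.refl_refl hΦ] using S.lattice_refl_stable α hΦ _ h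
  | one => exact fun _ => Iff.rfl
  | mul x y _ _ hx hy => exact fun v => (hx (y v)).trans (hy v)
  | inv x _ hx =>
    intro v
    rw [← hx (x⁻¹ v), ← LinearEquiv.mul_apply, mul_inv_cancel, LinearEquiv.coe_one, id]

theorem σ_inv_eq_pow : S.σ⁻¹ = S.σ ^ (S.M - 1) := by
  rw [inv_eq_iff_mul_eq_one, ← pow_succ', Nat.sub_add_cancel S.M_pos, S.σ_pow_eq_one]

theorem σ_inv_mem_lattice {v : V} (hv : v ∈ S.Λ) : S.σ⁻¹ v ∈ S.Λ := by
  rw [S.σ_inv_eq_pow]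
  generalize S.M - 1 = n
  induction n with
  | zero => simpa using hv
  | succ n ih => rw [pow_succ', LinearEquiv.mul_apply]; exact S.lattice_σ_stable _ ih

theorem σW_refl {α : Module.Dual ℚ V} (hα : α ∈ S.Φ) :
    S.σW (S.refl α) = S.refl (S.dualAct α) := by
  ext v
  have hσ : S.σ (S.σ⁻¹ v) = v := S.σ.apply_symm_apply v
  simp only [σW, LinearEquiv.mul_apply, S.refl_apply α hα,
    S.refl_apply (S.dualAct α) (S.σ_root α hα), map_sub, map_smul, S.σ_coroot α hα, hσ]
  rfl

theorem σW_mem_weyl {w : V ≃ₗ[ℚ] V} (hw : w ∈ S.weyl) : S.σW w ∈ S.weyl := by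
  have hle : S.weyl ≤ S.weyl.comap (MulAut.conj S.σ).toMonoidHom := by
    rw [weyl, weylSub, Subgroup.closure_le]
    rintro _ ⟨α, hα, rfl⟩
    exact Subgroup.subset_closure
      ⟨S.dualAct α, S.σ_simple α hα, (S.σW_refl (S.mem_root_of_mem_simple hα)).symm⟩
  exact hle hw

theorem σ_inv_conj_mem_weyl {w : V ≃ₗ[ℚ] V} (hw : w ∈ S.weyl) :
    S.σ⁻¹ * w * S.σ ∈ S.weyl := by
  have key : ∀ n : ℕ, S.σ ^ n * w * (S.σ ^ n)⁻¹ ∈ S.weyl := by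
    intro n
    induction n with
    | zero => simpa using hw
    | succ n ih =>
      have := S.σW_mem_weyl ih
      simpa only [σW, pow_succ', mul_inv_rev, mul_assoc] using this
  simpa only [← S.σ_inv_eq_pow, inv_inv] using key (S.M - 1)

/-- Two positive Coxeter pairs with the same support `J` and the same
`J`-point are `σ`-conjugate in `W̃`. -/
theorem statement18 (w₁ w₂ : V ≃ₗ[ℚ] V) (μ₁ μ₂ : V)
    (hw₁ : w₁ ∈ S.weyl) (hμ₁ : μ₁ ∈ S.Λ) (hw₂ : w₂ ∈ S.weyl) (hμ₂ : μ₂ ∈ S.Λ)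
    (v₁ v₂ : V ≃ₗ[ℚ] V) (J : Set (Module.Dual ℚ V))
    (h1 : S.IsPosCoxPair (w₁, μ₁) v₁ J) (h2 : S.IsPosCoxPair (w₂, μ₂) v₂ J)
    (c₁ c₂ : V ≃ₗ[ℚ] V)
    (hc₁ : c₁ = v₁⁻¹ * S.σW (w₁ * v₁)) (hc₂ : c₂ = v₂⁻¹ * S.σW (w₂ * v₂))
    (hpt : ∃ u ∈ S.weylSub J, (S.σ⁻¹ * u * S.σ) * c₁ * u⁻¹ = c₂ ∧
      ∃ lam ∈ S.Λ, u (S.σ (v₁.symm μ₁)) - S.σ (v₂.symm μ₂) = lam - S.σ (c₂ lam)) :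
    ∃ y : (V ≃ₗ[ℚ] V) × V, S.memE y ∧ (w₂, μ₂) = S.sigmaConjE y (w₁, μ₁) := by
  obtain ⟨u, hu, huc, lam, hlam, heq⟩ := hpt
  have hv₁ := h1.1.1
  have hv₂ := h2.1.1
  have huW : u ∈ S.weyl := S.weylSub_le_weyl h1.2.1 hu
  have hc₂W : c₂ ∈ S.weyl := by
    rw [hc₂]
    exact mul_mem (inv_mem hv₂) (S.σW_mem_weyl (mul_mem hw₂ hv₂))
  have hw₁eq : w₁ = S.σ⁻¹ * v₁ * c₁ * S.σ * v₁⁻¹ := by rw [hc₁, σW]; group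
  have hw₂eq : w₂ = S.σ⁻¹ * v₂ * c₂ * S.σ * v₂⁻¹ := by rw [hc₂, σW]; group
  refine ⟨(S.σ⁻¹ * (v₁ * (S.σ⁻¹ * u⁻¹ * S.σ) * v₂⁻¹) * S.σ, (S.σ⁻¹ * v₂ * c₂) lam),
    ⟨S.σ_inv_conj_mem_weyl (mul_mem (mul_mem hv₁ (S.σ_inv_conj_mem_weyl (inv_mem huW)))
      (inv_mem hv₂)), S.σ_inv_mem_lattice ((S.apply_mem_lattice_iff_of_mem_weyl hv₂ _).2
        ((S.apply_mem_lattice_iff_of_mem_weyl hc₂W _).2 hlam))⟩, ?_⟩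
  refine Prod.ext ?_ ?_
  · simp only [sigmaConjE, mulE, invE, sigmaE, σW]
    rw [hw₂eq, hw₁eq, ← huc]
    group
  · simp only [sigmaConjE, mulE, invE, sigmaE, σW]
    have h : ∀ (f g : V ≃ₗ[ℚ] V) (v : V), f (g v) = (f * g) v := fun _ _ _ => rfl
    have hs : ∀ f : V ≃ₗ[ℚ] V, f.symm = f⁻¹ := fun _ => rfl
    have hμ : μ₂ = (v₂ * S.σ⁻¹ * u * S.σ * v₁⁻¹) μ₁
        - (v₂ * S.σ⁻¹) lam + (v₂ * c₂) lam := by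
      apply (S.σ * v₂⁻¹).injective
      simp only [hs, h] at heq
      simp only [map_add, map_sub, h]
      rw [show S.σ * v₂⁻¹ * (v₂ * S.σ⁻¹ * u * S.σ * v₁⁻¹) = u * (S.σ * v₁⁻¹) by group,
        show S.σ * v₂⁻¹ * (v₂ * S.σ⁻¹) = 1 by group,
        show S.σ * v₂⁻¹ * (v₂ * c₂) = S.σ * c₂ by group, LinearEquiv.coe_one, id]
      linear_combination (norm := module) (-1 : ℚ) • heq
    have hc₁' : c₁ = S.σ⁻¹ * u⁻¹ * S.σ * c₂ * u := by rw [← huc]; group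
    simp only [hs, map_neg, map_add, h]
    rw [hμ, hw₁eq, hc₁']
    simp only [mul_assoc, mul_inv_rev, inv_inv, mul_inv_cancel_left, inv_mul_cancel_left,
      inv_mul_cancel, mul_inv_cancel, mul_one]
    abel

end Setting
end
end
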